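/- Define N_B(τ) = Σ_{(k,n)∈ℕ², (k²−k+1)(n²+1)²<τ} 2(2k+1) and Z = Σ_{n∈ℕ} 2(n²+1)^{−2}. Then limsup_{τ→+∞} |N_B(τ) − Z·τ| / τ^{1/2} ≥ (3/2)·Σ_{n∈ℕ} (n²+1)^{−1} > 0. -/

import Mathlib

open Filter Topology

/-- counting function of the first factor -/
noncomputable def cnt (l : ℝ) : ℝ :=
  ∑' k : ℕ, if (k : ℝ) ^ 2 - (k : ℝ) + 1 < l then 2 * (k : ℝ) + 1 else 0

lemma ev_ge_one (k : ℕ) : (1 : ℝ) ≤ (k : ℝ) ^ 2 - (k : ℝ) + 1 := by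
  rcases Nat.eq_zero_or_pos k with h | h
  · subst h; norm_num
  · have : (1 : ℝ) ≤ k := by exact_mod_cast h
    nlinarith

lemma ev_ge_self (k : ℕ) : (k : ℝ) ≤ (k : ℝ) ^ 2 - (k : ℝ) + 1 := by
  nlinarith [sq_nonneg ((k : ℝ) - 1)]

lemma cnt_small {l : ℝ} (h : l ≤ 1) : cnt l = 0 := by
  unfold cnt
  have : ∀ k : ℕ, (if (k : ℝ) ^ 2 - (k : ℝ) + 1 < l then 2 * (k : ℝ) + 1 else 0) = 0 := by
    intro k
    rw [if_neg]
    have := ev_ge_one k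
    linarith
  simp [this]

lemma sum_odd (K : ℕ) : ∑ k ∈ Finset.range K, (2 * (k : ℝ) + 1) = (K : ℝ) ^ 2 := by
  induction K with
  | zero => simp
  | succ n ih => rw [Finset.sum_range_succ, ih]; push_cast; ring

lemma cnt_big {l : ℝ} (h : 1 < l) : ∃ K : ℕ, 2 ≤ K ∧ cnt l = (K : ℝ) ^ 2 ∧
    l ≤ (K : ℝ) ^ 2 - K + 1 ∧ (K : ℝ) ^ 2 - 3 * K + 3 < l := by
  classical
  have hex : ∃ k : ℕ, l ≤ (k : ℝ) ^ 2 - (k : ℝ) + 1 := by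
    obtain ⟨k, hk⟩ := exists_nat_ge l
    exact ⟨k, hk.trans (ev_ge_self k)⟩
  have hs := Nat.find_spec hex
  have hm : ∀ m < Nat.find hex, (m : ℝ) ^ 2 - (m : ℝ) + 1 < l := fun m hm =>
    not_le.1 (Nat.find_min hex hm)
  generalize Nat.find hex = K at hs hm
  have hK : 2 ≤ K := by
    by_contra hc
    have : K = 0 ∨ K = 1 := by omega
    rcases this with h0 | h0 <;> subst h0 <;> norm_num at hs <;> linarith
  have hK' : (2 : ℝ) ≤ K := by exact_mod_cast hK
  refine ⟨K, hK, ?_, hs, ?_⟩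
  · unfold cnt
    rw [tsum_eq_sum (s := Finset.range K), ← sum_odd]
    · apply Finset.sum_congr rfl
      intro k hk
      rw [if_pos (hm k (Finset.mem_range.1 hk))]
    · intro k hk
      rw [if_neg]
      have hk' : (K : ℝ) ≤ k := by
        have : K ≤ k := by simpa using hk
        exact_mod_cast this
      nlinarith
  · have := hm (K - 1) (by omega)
    rw [Nat.cast_sub (by omega)] at this
    push_cast at this
    nlinarith

lemma cnt_upper {s : ℝ} (hs : 0 ≤ s) : cnt (s ^ 2) ≤ s ^ 2 + 6 * s := by
  rcases le_or_gt (s ^ 2) 1 with h | h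
  · rw [cnt_small h]; positivity
  · obtain ⟨K, hK, e, h1, h2⟩ := cnt_big h
    have hK' : (2 : ℝ) ≤ K := by exact_mod_cast hK
    rw [e]
    have : (K : ℝ) / 2 ≤ s := by
      apply le_of_sq_le_sq _ hs
      nlinarith [sq_nonneg ((K : ℝ) - 2)]
    nlinarith

lemma cnt_lower {s : ℝ} (hs : 0 ≤ s) : s ^ 2 + s - 2 * min 1 s ≤ cnt (s ^ 2) := by
  rcases le_or_gt (s ^ 2) 1 with h | h
  · have h1 : s ≤ 1 := by nlinarith
    rw [cnt_small h, min_eq_right h1]; nlinarith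
  · obtain ⟨K, hK, e, h1, h2⟩ := cnt_big h
    have hK' : (2 : ℝ) ≤ K := by exact_mod_cast hK
    rw [e]
    have h3 : 1 ≤ s := by nlinarith
    have : s ≤ K := by
      apply le_of_sq_le_sq _ (by positivity)
      nlinarith
    rw [min_eq_left h3]
    nlinarith

lemma summable_a : Summable (fun n : ℕ => ((n : ℝ) ^ 2 + 1)⁻¹) := by
  have h := (summable_nat_add_iff (f := fun n : ℕ => ((n : ℝ) ^ 2)⁻¹) 1).2
    (Real.summable_nat_pow_inv.2 (by norm_num))
  refine Summable.of_nonneg_of_le (fun n => by positivity) (fun n => ?_) (h.mul_left 2)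
  have : 2 * (((n + 1 : ℕ) : ℝ) ^ 2)⁻¹ = ((((n + 1 : ℕ) : ℝ) ^ 2) / 2)⁻¹ := by
    rw [inv_div]; rfl
  rw [this]
  apply inv_anti₀ (by positivity)
  push_cast
  nlinarith [sq_nonneg ((n : ℝ) - 1)]

lemma summable_a2 : Summable (fun n : ℕ => (((n : ℝ) ^ 2 + 1) ^ 2)⁻¹) := by
  refine Summable.of_nonneg_of_le (fun n => by positivity) (fun n => ?_) summable_a
  apply inv_anti₀ (by positivity)
  nlinarith [sq_nonneg (n : ℝ), sq_nonneg ((n : ℝ) ^ 2)]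

lemma count_eq (t : ℝ) : HasSum (fun n : ℕ => 2 * cnt ((t * ((n : ℝ) ^ 2 + 1)⁻¹) ^ 2))
    (∑' q : {q : ℕ × ℕ |
              ((q.1 : ℝ) ^ 2 - (q.1 : ℝ) + 1) * ((q.2 : ℝ) ^ 2 + 1) ^ 2 < t ^ 2},
            2 * (2 * ((q.1.1 : ℕ) : ℝ) + 1)) := by
  classical
  set S := {q : ℕ × ℕ |
              ((q.1 : ℝ) ^ 2 - (q.1 : ℝ) + 1) * ((q.2 : ℝ) ^ 2 + 1) ^ 2 < t ^ 2} with hS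
  have hfin : S.Finite := by
    obtain ⟨N, hN⟩ := exists_nat_ge (t ^ 2)
    apply Set.Finite.subset (Finset.finite_toSet (Finset.range N ×ˢ Finset.range N))
    rintro ⟨k, n⟩ hq
    simp only [hS, Set.mem_setOf_eq] at hq
    have e1 := ev_ge_one k
    have e2 := ev_ge_self k
    have e3 : (1 : ℝ) ≤ ((n : ℝ) ^ 2 + 1) ^ 2 := by nlinarith [sq_nonneg (n : ℝ)]
    have e4 : (n : ℝ) ≤ ((n : ℝ) ^ 2 + 1) ^ 2 := by
      nlinarith [sq_nonneg (n : ℝ), sq_nonneg ((n : ℝ) - 1), sq_nonneg ((n : ℝ) ^ 2)]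
    have a1 : (k : ℝ) < N := by nlinarith
    have a2 : (n : ℝ) < N := by nlinarith
    simp only [Finset.coe_product, Set.mem_prod, Finset.mem_coe, Finset.mem_range]
    exact ⟨by exact_mod_cast a1, by exact_mod_cast a2⟩
  have hsum : Summable (S.indicator (fun q : ℕ × ℕ => 2 * (2 * (q.1 : ℝ) + 1))) :=
    summable_of_finite_support (hfin.subset Set.support_indicator_subset)
  have hsw := (Equiv.prodComm ℕ ℕ).summable_iff.2 hsum
  have h1 : (∑' q : S, 2 * (2 * ((q.1.1 : ℕ) : ℝ) + 1)) =
      ∑' p, (S.indicator (fun q : ℕ × ℕ => 2 * (2 * (q.1 : ℝ) + 1)) ∘ (Equiv.prodComm ℕ ℕ)) p := by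
    rw [tsum_subtype S (fun q : ℕ × ℕ => 2 * (2 * (q.1 : ℝ) + 1))]
    exact ((Equiv.prodComm ℕ ℕ).tsum_eq _).symm
  rw [h1]
  have h2 : (fun n : ℕ => 2 * cnt ((t * ((n : ℝ) ^ 2 + 1)⁻¹) ^ 2)) = fun n => ∑' k,
      (S.indicator (fun q : ℕ × ℕ => 2 * (2 * (q.1 : ℝ) + 1)) ∘ (Equiv.prodComm ℕ ℕ)) (n, k) := by
    funext n
    unfold cnt
    rw [← tsum_mul_left]
    congr 1
    funext k
    have hiff : ((k : ℝ) ^ 2 - (k : ℝ) + 1 < (t * ((n : ℝ) ^ 2 + 1)⁻¹) ^ 2) ↔ (k, n) ∈ S := by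
      simp only [hS, Set.mem_setOf_eq]
      rw [mul_pow, inv_pow, ← div_eq_mul_inv, lt_div_iff₀ (by positivity)]
    simp only [Function.comp, Equiv.prodComm_apply, Prod.swap, Set.indicator_apply]
    by_cases hc : (k, n) ∈ S
    · rw [if_pos hc, if_pos (hiff.2 hc)]
    · rw [if_neg hc, if_neg (fun h => hc (hiff.1 h)), mul_zero]
  rw [h2]
  exact hsw.hasSum.prod_fiberwise (fun n => (hsw.prod_factor n).hasSum)

theorem sharpness_case_one :
    3 / 2 * (∑' n : ℕ, ((n : ℝ) ^ 2 + 1)⁻¹) ≤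
      Filter.limsup (fun τ : ℝ =>
        |(∑' q : {q : ℕ × ℕ |
              ((q.1 : ℝ) ^ 2 - (q.1 : ℝ) + 1) * ((q.2 : ℝ) ^ 2 + 1) ^ 2 < τ},
            2 * (2 * ((q.1.1 : ℕ) : ℝ) + 1)) -
          (∑' n : ℕ, 2 * (((n : ℝ) ^ 2 + 1) ^ 2)⁻¹) * τ| / τ ^ (1 / 2 : ℝ)) Filter.atTop ∧
    0 < 3 / 2 * (∑' n : ℕ, ((n : ℝ) ^ 2 + 1)⁻¹) := by
  set A := ∑' n : ℕ, ((n : ℝ) ^ 2 + 1)⁻¹ with hA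
  have hApos : 0 < A := summable_a.tsum_pos (fun n => by positivity) 0 (by norm_num)
  have hHA : HasSum (fun n : ℕ => ((n : ℝ) ^ 2 + 1)⁻¹) A := summable_a.hasSum
  refine ⟨?_, by positivity⟩
  set Z := ∑' n : ℕ, 2 * (((n : ℝ) ^ 2 + 1) ^ 2)⁻¹ with hZ
  have hHZ : HasSum (fun n : ℕ => 2 * (((n : ℝ) ^ 2 + 1) ^ 2)⁻¹) Z :=
    (summable_a2.mul_left 2).hasSum
  -- error term
  have hsm : ∀ t : ℝ, 0 < t → Summable (fun n : ℕ => min t⁻¹ (((n : ℝ) ^ 2 + 1)⁻¹)) := fun t ht =>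
    Summable.of_nonneg_of_le (fun n => by positivity) (fun n => min_le_right _ _) summable_a
  have herr : Tendsto (fun t : ℝ => ∑' n : ℕ, min t⁻¹ (((n : ℝ) ^ 2 + 1)⁻¹)) atTop (𝓝 0) := by
    have := tendsto_tsum_of_dominated_convergence (𝓕 := (atTop : Filter ℝ))
      (f := fun (t : ℝ) (n : ℕ) => min t⁻¹ (((n : ℝ) ^ 2 + 1)⁻¹)) (g := fun _ => (0 : ℝ))
      summable_a (fun n => by
        have h := (tendsto_inv_atTop_zero (𝕜 := ℝ)).min
          (tendsto_const_nhds (x := ((n : ℝ) ^ 2 + 1)⁻¹))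
        rwa [min_eq_left (by positivity : (0 : ℝ) ≤ ((n : ℝ) ^ 2 + 1)⁻¹)] at h)
      (by
        filter_upwards [eventually_gt_atTop 0] with t ht n
        rw [Real.norm_of_nonneg (by positivity)]
        exact min_le_right _ _)
    simpa using this
  have key : ∀ t : ℝ, 0 < t → ∀ N : ℝ,
      HasSum (fun n : ℕ => 2 * cnt ((t * ((n : ℝ) ^ 2 + 1)⁻¹) ^ 2)) N →
      (2 * A - 4 * ∑' n : ℕ, min t⁻¹ (((n : ℝ) ^ 2 + 1)⁻¹)) * t ≤ N - Z * t ^ 2 ∧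
      N - Z * t ^ 2 ≤ 12 * A * t := by
    intro t ht N hN
    have hD := hN.sub (hHZ.mul_right (t ^ 2))
    constructor
    · refine hasSum_le (fun n => ?_)
        (((hHA.mul_left 2).sub ((hsm t ht).hasSum.mul_left 4)).mul_right t) hD
      have hl := cnt_lower (s := t * ((n : ℝ) ^ 2 + 1)⁻¹) (by positivity)
      have e : t * min t⁻¹ (((n : ℝ) ^ 2 + 1)⁻¹) = min 1 (t * ((n : ℝ) ^ 2 + 1)⁻¹) := by
        rw [mul_min_of_nonneg _ _ ht.le, mul_inv_cancel₀ ht.ne']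
      rw [← e] at hl
      rw [← inv_pow]
      linarith
    · refine hasSum_le (fun n => ?_) hD ((hHA.mul_left 12).mul_right t)
      have hl := cnt_upper (s := t * ((n : ℝ) ^ 2 + 1)⁻¹) (by positivity)
      rw [← inv_pow]
      linarith
  have hsmall : ∀ᶠ t : ℝ in atTop, ∑' n : ℕ, min t⁻¹ (((n : ℝ) ^ 2 + 1)⁻¹) < A / 8 :=
    herr.eventually_lt_const (by positivity)
  have hsq : Tendsto Real.sqrt atTop atTop := Real.tendsto_sqrt_atTop
  have hbd : ∀ᶠ τ : ℝ in atTop, 3 / 2 * A ≤ |(∑' q : {q : ℕ × ℕ |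
              ((q.1 : ℝ) ^ 2 - (q.1 : ℝ) + 1) * ((q.2 : ℝ) ^ 2 + 1) ^ 2 < τ},
            2 * (2 * ((q.1.1 : ℕ) : ℝ) + 1)) - Z * τ| / τ ^ (1 / 2 : ℝ) ∧
        |(∑' q : {q : ℕ × ℕ |
              ((q.1 : ℝ) ^ 2 - (q.1 : ℝ) + 1) * ((q.2 : ℝ) ^ 2 + 1) ^ 2 < τ},
            2 * (2 * ((q.1.1 : ℕ) : ℝ) + 1)) - Z * τ| / τ ^ (1 / 2 : ℝ) ≤ 12 * A := by
    filter_upwards [hsq.eventually hsmall, eventually_gt_atTop 0] with τ h1 h2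
    rw [← Real.sqrt_eq_rpow]
    have ht : 0 < √τ := Real.sqrt_pos.2 h2
    have hN := count_eq (√τ)
    have hk := key _ ht _ hN
    rw [Real.sq_sqrt h2.le] at hk
    obtain ⟨k1, k2⟩ := hk
    have hlow : 3 / 2 * A * √τ ≤ (2 * A - 4 * ∑' n : ℕ, min (√τ)⁻¹ (((n : ℝ) ^ 2 + 1)⁻¹)) * √τ := by
      apply mul_le_mul_of_nonneg_right _ ht.le
      linarith
    have hpos : 0 ≤ 3 / 2 * A * √τ := by positivity
    rw [abs_of_nonneg (by linarith), le_div_iff₀ ht, div_le_iff₀ ht]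
    exact ⟨by linarith, k2⟩
  exact le_limsup_of_frequently_le (hbd.mono fun _ h => h.1).frequently
    (isBoundedUnder_of_eventually_le (hbd.mono fun _ h => h.2))
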